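/- There exists a specification ⟨Π^F, Π^G, Δ⟩ such that Π^F ∪ Π^G ∪ Δ is non-contradictory, but none of the six relations ≲P1, ≲P2, ≲P3, <P1, <P2, <P3 (the latter three being the strict parts <N := ≲N \ ≳N) is transitive. -/

import Mathlib

/-- A literal: an atom, possibly prefixed with negation. -/
inductive Lit (α : Type) : Type where
  | pos : α → Lit α
  | neg : α → Lit α
  deriving DecidableEq

/-- A (ground) rule: a head literal together with a finite (possibly empty)
conjunction of body literals.  A rule with empty body is just a literal. -/
structure Rule (α : Type) : Type where
  head : Lit α
  body : Finset (Lit α)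
  deriving DecidableEq

/-- View a set of literals as a set of bodiless rules. -/
def litRules {α : Type} (S : Set (Lit α)) : Set (Rule α) :=
  {r | r.head ∈ S ∧ r.body = ∅}

/-- The theory `𝔗_P` of a set of rules `P`: the least set of literals
containing the bodiless rules of `P` and closed under the rules of `P`. -/
inductive Th {α : Type} (P : Set (Rule α)) : Lit α → Prop where
  | step (r : Rule α) (hr : r ∈ P) (ih : ∀ l ∈ r.body, Th P l) : Th P r.head

/-- A set of rules is contradictory iff it derives both `A` and `¬A`
for some atom `A`. -/
def Contradictory {α : Type} (P : Set (Rule α)) : Prop :=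
  ∃ a : α, Th P (Lit.pos a) ∧ Th P (Lit.neg a)

/-- A defeasible specification `⟨Π^F, Π^G, Δ⟩`:
facts, general (strict) rules, and defeasible rules (all taken ground). -/
structure Spec (α : Type) : Type where
  F : Set (Lit α)
  G : Set (Rule α)
  D : Set (Rule α)

namespace Spec

variable {α : Type}

/-- `Π := Π^F ∪ Π^G`. -/
def strict (S : Spec α) : Set (Rule α) := litRules S.F ∪ S.G

/-- `𝔗_Π`. -/
def ThStrict (S : Spec α) : Set (Lit α) := {l | Th S.strict l}

/-- `𝔗_{Π ∪ Δ}`. -/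
def ThAll (S : Spec α) : Set (Lit α) := {l | Th (S.strict ∪ S.D) l}

/-- `⟨A, L⟩` is an argument: `A` is a set of (ground instances of) defeasible
rules from `Δ` and `A ∪ Π` derives `L`. -/
def IsArgument (S : Spec α) (A : Set (Rule α)) (L : Lit α) : Prop :=
  A ⊆ S.D ∧ Th (A ∪ S.strict) L

/-- `H` is a simplified activation set for `⟨A, L⟩`:  `L ∈ 𝔗_{H ∪ A ∪ Π^G}`. -/
def SAct (S : Spec α) (A : Set (Rule α)) (L : Lit α) (H : Set (Lit α)) : Prop :=
  Th (litRules H ∪ A ∪ S.G) L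

/-- `H` is an activation set for `⟨A, L⟩`:
`L ∈ 𝔗_{𝔏 ∪ Π}` for some `𝔏 ⊆ 𝔗_{H ∪ A ∪ Π^G}`. -/
def Act (S : Spec α) (A : Set (Rule α)) (L : Lit α) (H : Set (Lit α)) : Prop :=
  ∃ Ls : Set (Lit α), Ls ⊆ {l | Th (litRules H ∪ A ∪ S.G) l} ∧
    Th (litRules Ls ∪ S.strict) L

/-- `H` is a minimal simplified activation set for `⟨A, L⟩`. -/
def MinSAct (S : Spec α) (A : Set (Rule α)) (L : Lit α) (H : Set (Lit α)) : Prop :=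
  S.SAct A L H ∧ ∀ H' ⊂ H, ¬ S.SAct A L H'

/-- `H` is a minimal activation set for `⟨A, L⟩`. -/
def MinAct (S : Spec α) (A : Set (Rule α)) (L : Lit α) (H : Set (Lit α)) : Prop :=
  S.Act A L H ∧ ∀ H' ⊂ H, ¬ S.Act A L H'

/-- Poole's original specificity relation `≲P1`. -/
def leP1 (S : Spec α) (X Y : Set (Rule α) × Lit α) : Prop :=
  S.IsArgument X.1 X.2 ∧ S.IsArgument Y.1 Y.2 ∧
    ∀ H ⊆ S.ThAll, S.SAct X.1 X.2 H → ¬ S.SAct Y.1 X.2 H → S.SAct Y.1 Y.2 H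

/-- The standard version `≲P2` of Poole's specificity. -/
def leP2 (S : Spec α) (X Y : Set (Rule α) × Lit α) : Prop :=
  S.IsArgument X.1 X.2 ∧ S.IsArgument Y.1 Y.2 ∧
    ∀ H ⊆ S.ThAll, S.SAct X.1 X.2 H → ¬ S.SAct ∅ X.2 H → S.SAct Y.1 Y.2 H

/-- The rather unflawed version `≲P3` of Poole's specificity. -/
def leP3 (S : Spec α) (X Y : Set (Rule α) × Lit α) : Prop :=
  S.IsArgument X.1 X.2 ∧ S.IsArgument Y.1 Y.2 ∧
    (Y.2 ∈ S.ThStrict → X.2 ∈ S.ThStrict) ∧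
    ∀ H ⊆ S.ThAll, S.SAct X.1 X.2 H → ¬ S.SAct ∅ X.2 H → S.SAct Y.1 Y.2 H

/-- The corrected specificity relation `≲CP`. -/
def leCP (S : Spec α) (X Y : Set (Rule α) × Lit α) : Prop :=
  S.IsArgument X.1 X.2 ∧ S.IsArgument Y.1 Y.2 ∧
    (X.2 ∈ S.ThStrict ∨
      (Y.2 ∉ S.ThStrict ∧
        ∀ H ⊆ S.ThStrict, S.Act X.1 X.2 H → S.Act Y.1 Y.2 H))

/-- `<P1 := ≲P1 \ ≳P1`. -/
def ltP1 (S : Spec α) (X Y : Set (Rule α) × Lit α) : Prop := S.leP1 X Y ∧ ¬ S.leP1 Y X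
/-- `<P2 := ≲P2 \ ≳P2`. -/
def ltP2 (S : Spec α) (X Y : Set (Rule α) × Lit α) : Prop := S.leP2 X Y ∧ ¬ S.leP2 Y X
/-- `<P3 := ≲P3 \ ≳P3`. -/
def ltP3 (S : Spec α) (X Y : Set (Rule α) × Lit α) : Prop := S.leP3 X Y ∧ ¬ S.leP3 Y X
/-- `<CP := ≲CP \ ≳CP`. -/
def ltCP (S : Spec α) (X Y : Set (Rule α) × Lit α) : Prop := S.leCP X Y ∧ ¬ S.leCP Y X

/-- `Π^{<2}`: rules of `Π` with at most one body literal. -/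
def strictLt2 (S : Spec α) : Set (Rule α) := {r ∈ S.strict | r.body.card ≤ 1}

/-- `Π^{≥2}`: rules of `Π` with at least two body literals. -/
def strictGe2 (S : Spec α) : Set (Rule α) := {r ∈ S.strict | 2 ≤ r.body.card}

/-- Condition 1 of Theorem 16. -/
def Cond1 (S : Spec α) : Prop :=
  ∀ H ⊆ S.ThStrict, ∀ A ⊆ S.D,
    {l | Th (litRules {l | Th (litRules H ∪ A ∪ S.G) l} ∪ S.strict) l} ⊆
      {l | Th (litRules H ∪ A ∪ S.G) l} ∪ S.ThStrict

/-- Condition 2 of Theorem 16. -/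
def Cond2 (S : Spec α) : Prop :=
  ∀ r ∈ S.strictGe2, r.head ∉ {l | Th S.strictLt2 l} →
    ∀ l ∈ r.body, l ∉ {l | Th S.strictLt2 l}

/-- Condition 3 of Theorem 16. -/
def Cond3 (S : Spec α) : Prop :=
  ∀ r ∈ S.strictGe2, ∀ l ∈ r.body, l ∉ S.ThStrict

/-- Condition 4 of Theorem 16. -/
def Cond4 (S : Spec α) : Prop := S.strictGe2 = ∅

end Spec

theorem Th.iff_exists_rule {α : Type} {P : Set (Rule α)} {L : Lit α} :
    Th P L ↔ ∃ r ∈ P, r.head = L ∧ ∀ l ∈ r.body, Th P l := by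
  constructor
  · rintro ⟨r, hr, ih⟩
    exact ⟨r, hr, rfl, ih⟩
  · rintro ⟨r, hr, rfl, ih⟩
    exact Th.step r hr ih

theorem Spec.sAct_iff {α : Type} {S : Spec α} {A : Set (Rule α)} {L : Lit α}
    {H : Set (Lit α)} :
    S.SAct A L H ↔
      L ∈ H ∨ ∃ r, (r ∈ A ∨ r ∈ S.G) ∧ r.head = L ∧ ∀ l ∈ r.body, S.SAct A l H := by
  constructor
  · intro h
    obtain ⟨r, (⟨hr, -⟩ | hr) | hr, rfl, hb⟩ := Th.iff_exists_rule.1 h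
    · exact .inl hr
    · exact .inr ⟨r, .inl hr, rfl, hb⟩
    · exact .inr ⟨r, .inr hr, rfl, hb⟩
  · rintro (h | ⟨r, hr, rfl, hb⟩)
    · exact Th.step ⟨L, ∅⟩ (.inl (.inl ⟨h, rfl⟩)) (by simp)
    · exact Th.step r (hr.elim (fun h => .inl (.inr h)) .inr) hb

theorem Spec.isArgument_iff {α : Type} {S : Spec α} {A : Set (Rule α)} {L : Lit α} :
    S.IsArgument A L ↔ A ⊆ S.D ∧ S.SAct A L S.F := by
  have h : A ∪ S.strict = litRules S.F ∪ A ∪ S.G := by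
    rw [Spec.strict, Set.union_left_comm, Set.union_assoc]
  rw [Spec.IsArgument, Spec.SAct, h]

theorem Spec.mem_thStrict_iff {α : Type} {S : Spec α} {L : Lit α} :
    L ∈ S.ThStrict ↔ S.SAct ∅ L S.F := by
  simp [Spec.ThStrict, Spec.SAct, Spec.strict]

theorem Spec.F_subset_thAll {α : Type} (S : Spec α) : S.F ⊆ S.ThAll := fun l hl =>
  Th.step ⟨l, ∅⟩ (.inl (.inl ⟨hl, rfl⟩)) (by simp)

namespace NontransitiveSpecificity

inductive Atom : Type where
  | a | b | x | y | z
  deriving DecidableEq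

open Atom Lit

/-- The rule `p ← q` between positive literals. -/
def rule (p q : Atom) : Rule Atom := ⟨pos p, {pos q}⟩

/-- Facts `a`, `b`, `x`; general rule `y ← a`; defeasible rules
`x ← a`, `y ← b`, `z ← b` and `z ← x`. -/
def spec : Spec Atom where
  F := {pos a, pos b, pos x}
  G := {rule y a}
  D := {rule x a, rule y b, rule z b, rule z x}

def rulesX : Set (Rule Atom) := {rule x a}
def rulesY : Set (Rule Atom) := {rule y b}
def rulesZ : Set (Rule Atom) := {rule z b, rule z x}

theorem mem_rulesX {r : Rule Atom} : r ∈ rulesX ↔ r = rule x a := Iff.rfl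
theorem mem_rulesY {r : Rule Atom} : r ∈ rulesY ↔ r = rule y b := Iff.rfl
theorem mem_rulesZ {r : Rule Atom} : r ∈ rulesZ ↔ r = rule z b ∨ r = rule z x := Iff.rfl
theorem mem_spec_G {r : Rule Atom} : r ∈ spec.G ↔ r = rule y a := Iff.rfl

theorem not_contradictory : ¬ Contradictory (litRules spec.F ∪ spec.G ∪ spec.D) := by
  rintro ⟨c, -, h⟩
  obtain ⟨r, hr, hh, -⟩ := Th.iff_exists_rule.1 h
  rcases r with ⟨head, body⟩
  obtain rfl : head = neg c := hh
  simp [litRules, spec, rule] at hr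

section

variable {H : Set (Lit Atom)}

@[simp] theorem sAct_rulesX_a :
    spec.SAct rulesX (pos a) H ↔ pos a ∈ H := by
  rw [Spec.sAct_iff]
  simp [mem_rulesX, mem_spec_G, rule]

@[simp] theorem sAct_rulesX_x :
    spec.SAct rulesX (pos x) H ↔ pos x ∈ H ∨ pos a ∈ H := by
  rw [Spec.sAct_iff]
  simp [mem_rulesX, mem_spec_G, rule]

@[simp] theorem sAct_rulesX_y :
    spec.SAct rulesX (pos y) H ↔ pos y ∈ H ∨ pos a ∈ H := by
  rw [Spec.sAct_iff]
  simp [mem_rulesX, mem_spec_G, rule]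

@[simp] theorem sAct_rulesY_a :
    spec.SAct rulesY (pos a) H ↔ pos a ∈ H := by
  rw [Spec.sAct_iff]
  simp [mem_rulesY, mem_spec_G, rule]

@[simp] theorem sAct_rulesY_b :
    spec.SAct rulesY (pos b) H ↔ pos b ∈ H := by
  rw [Spec.sAct_iff]
  simp [mem_rulesY, mem_spec_G, rule]

@[simp] theorem sAct_rulesY_x :
    spec.SAct rulesY (pos x) H ↔ pos x ∈ H := by
  rw [Spec.sAct_iff]
  simp [mem_rulesY, mem_spec_G, rule]

@[simp] theorem sAct_rulesY_y :
    spec.SAct rulesY (pos y) H ↔ pos y ∈ H ∨ pos b ∈ H ∨ pos a ∈ H := by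
  rw [Spec.sAct_iff]
  simp [mem_rulesY, mem_spec_G, rule]

@[simp] theorem sAct_rulesY_z :
    spec.SAct rulesY (pos z) H ↔ pos z ∈ H := by
  rw [Spec.sAct_iff]
  simp [mem_rulesY, mem_spec_G, rule]

@[simp] theorem sAct_rulesZ_a :
    spec.SAct rulesZ (pos a) H ↔ pos a ∈ H := by
  rw [Spec.sAct_iff]
  simp [mem_rulesZ, mem_spec_G, rule]

@[simp] theorem sAct_rulesZ_b :
    spec.SAct rulesZ (pos b) H ↔ pos b ∈ H := by
  rw [Spec.sAct_iff]
  simp [mem_rulesZ, mem_spec_G, rule]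

@[simp] theorem sAct_rulesZ_x :
    spec.SAct rulesZ (pos x) H ↔ pos x ∈ H := by
  rw [Spec.sAct_iff]
  simp [mem_rulesZ, mem_spec_G, rule]

@[simp] theorem sAct_rulesZ_y :
    spec.SAct rulesZ (pos y) H ↔ pos y ∈ H ∨ pos a ∈ H := by
  rw [Spec.sAct_iff]
  simp [mem_rulesZ, mem_spec_G, rule]

@[simp] theorem sAct_rulesZ_z :
    spec.SAct rulesZ (pos z) H ↔ pos z ∈ H ∨ pos b ∈ H ∨ pos x ∈ H := by
  rw [Spec.sAct_iff]
  simp [mem_rulesZ, mem_spec_G, rule]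

@[simp] theorem sAct_empty_a :
    spec.SAct ∅ (pos a) H ↔ pos a ∈ H := by
  rw [Spec.sAct_iff]
  simp [mem_spec_G, rule]

@[simp] theorem sAct_empty_x :
    spec.SAct ∅ (pos x) H ↔ pos x ∈ H := by
  rw [Spec.sAct_iff]
  simp [mem_spec_G, rule]

@[simp] theorem sAct_empty_y :
    spec.SAct ∅ (pos y) H ↔ pos y ∈ H ∨ pos a ∈ H := by
  rw [Spec.sAct_iff]
  simp [mem_spec_G, rule]

@[simp] theorem sAct_empty_z :
    spec.SAct ∅ (pos z) H ↔ pos z ∈ H := by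
  rw [Spec.sAct_iff]
  simp [mem_spec_G, rule]

end

theorem a_mem_F : pos a ∈ spec.F := by simp [spec]
theorem b_mem_F : pos b ∈ spec.F := by simp [spec]
theorem x_mem_F : pos x ∈ spec.F := by simp [spec]

theorem isArgument_X : spec.IsArgument rulesX (pos x) :=
  Spec.isArgument_iff.2 ⟨by simp [rulesX, spec], by simp [x_mem_F]⟩

theorem isArgument_Y : spec.IsArgument rulesY (pos y) :=
  Spec.isArgument_iff.2 ⟨by simp [rulesY, spec], by simp [a_mem_F]⟩

theorem isArgument_Z : spec.IsArgument rulesZ (pos z) :=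
  Spec.isArgument_iff.2
    ⟨by simp [rulesZ, spec, Set.insert_subset_iff], by simp [b_mem_F]⟩

theorem singleton_subset_thAll {l : Lit Atom} (h : l ∈ spec.F) : {l} ⊆ spec.ThAll :=
  Set.singleton_subset_iff.2 (spec.F_subset_thAll h)

theorem leP1_X_Y : spec.leP1 (rulesX, pos x) (rulesY, pos y) :=
  ⟨isArgument_X, isArgument_Y, fun H _ => by simp; tauto⟩

theorem leP1_Y_Z : spec.leP1 (rulesY, pos y) (rulesZ, pos z) :=
  ⟨isArgument_Y, isArgument_Z, fun H _ => by simp; tauto⟩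

theorem not_leP1_Y_X : ¬ spec.leP1 (rulesY, pos y) (rulesX, pos x) := by
  rintro ⟨-, -, h⟩
  simpa using h {pos b} (singleton_subset_thAll b_mem_F)

theorem not_leP1_Z_Y : ¬ spec.leP1 (rulesZ, pos z) (rulesY, pos y) := by
  rintro ⟨-, -, h⟩
  simpa using h {pos x} (singleton_subset_thAll x_mem_F)

theorem not_leP1_X_Z : ¬ spec.leP1 (rulesX, pos x) (rulesZ, pos z) := by
  rintro ⟨-, -, h⟩
  simpa using h {pos a} (singleton_subset_thAll a_mem_F)

theorem leP2_X_Y : spec.leP2 (rulesX, pos x) (rulesY, pos y) :=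
  ⟨isArgument_X, isArgument_Y, fun H _ => by simp; tauto⟩

theorem leP2_Y_Z : spec.leP2 (rulesY, pos y) (rulesZ, pos z) :=
  ⟨isArgument_Y, isArgument_Z, fun H _ => by simp; tauto⟩

theorem not_leP2_Y_X : ¬ spec.leP2 (rulesY, pos y) (rulesX, pos x) := by
  rintro ⟨-, -, h⟩
  simpa using h {pos b} (singleton_subset_thAll b_mem_F)

theorem not_leP2_Z_Y : ¬ spec.leP2 (rulesZ, pos z) (rulesY, pos y) := by
  rintro ⟨-, -, h⟩
  simpa using h {pos x} (singleton_subset_thAll x_mem_F)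

theorem not_leP2_X_Z : ¬ spec.leP2 (rulesX, pos x) (rulesZ, pos z) := by
  rintro ⟨-, -, h⟩
  simpa using h {pos a} (singleton_subset_thAll a_mem_F)

theorem leP3_X_Y : spec.leP3 (rulesX, pos x) (rulesY, pos y) :=
  ⟨isArgument_X, isArgument_Y,
    by simp [Spec.mem_thStrict_iff, a_mem_F, x_mem_F], fun H _ => by simp; tauto⟩

theorem leP3_Y_Z : spec.leP3 (rulesY, pos y) (rulesZ, pos z) :=
  ⟨isArgument_Y, isArgument_Z,
    by simp [Spec.mem_thStrict_iff, a_mem_F], fun H _ => by simp; tauto⟩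

theorem not_leP3_Y_X : ¬ spec.leP3 (rulesY, pos y) (rulesX, pos x) := by
  rintro ⟨-, -, -, h⟩
  simpa using h {pos b} (singleton_subset_thAll b_mem_F)

theorem not_leP3_Z_Y : ¬ spec.leP3 (rulesZ, pos z) (rulesY, pos y) := by
  rintro ⟨-, -, -, h⟩
  simpa using h {pos x} (singleton_subset_thAll x_mem_F)

theorem not_leP3_X_Z : ¬ spec.leP3 (rulesX, pos x) (rulesZ, pos z) := by
  rintro ⟨-, -, -, h⟩
  simpa using h {pos a} (singleton_subset_thAll a_mem_F)

theorem not_transitive_leP1 : ¬ Transitive spec.leP1 := fun h =>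
  not_leP1_X_Z (h leP1_X_Y leP1_Y_Z)

theorem not_transitive_ltP1 : ¬ Transitive spec.ltP1 := fun h =>
  not_leP1_X_Z
    (h ⟨leP1_X_Y, not_leP1_Y_X⟩ ⟨leP1_Y_Z, not_leP1_Z_Y⟩).1

theorem not_transitive_leP2 : ¬ Transitive spec.leP2 := fun h =>
  not_leP2_X_Z (h leP2_X_Y leP2_Y_Z)

theorem not_transitive_ltP2 : ¬ Transitive spec.ltP2 := fun h =>
  not_leP2_X_Z
    (h ⟨leP2_X_Y, not_leP2_Y_X⟩ ⟨leP2_Y_Z, not_leP2_Z_Y⟩).1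

theorem not_transitive_leP3 : ¬ Transitive spec.leP3 := fun h =>
  not_leP3_X_Z (h leP3_X_Y leP3_Y_Z)

theorem not_transitive_ltP3 : ¬ Transitive spec.ltP3 := fun h =>
  not_leP3_X_Z
    (h ⟨leP3_X_Y, not_leP3_Y_X⟩ ⟨leP3_Y_Z, not_leP3_Z_Y⟩).1

end NontransitiveSpecificity

/-- Theorem 7: there is a non-contradictory specification for which none of
`≲P1`, `≲P2`, `≲P3`, `<P1`, `<P2`, `<P3` is transitive. -/
theorem exists_noncontradictory_spec_with_nontransitive_specificity :
    ∃ (α : Type) (S : Spec α),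
      ¬ Contradictory (litRules S.F ∪ S.G ∪ S.D) ∧
      ¬ Transitive S.leP1 ∧ ¬ Transitive S.leP2 ∧ ¬ Transitive S.leP3 ∧
      ¬ Transitive S.ltP1 ∧ ¬ Transitive S.ltP2 ∧ ¬ Transitive S.ltP3 := by
  exact ⟨NontransitiveSpecificity.Atom, NontransitiveSpecificity.spec, NontransitiveSpecificity.not_contradictory,
    NontransitiveSpecificity.not_transitive_leP1, NontransitiveSpecificity.not_transitive_leP2,
    NontransitiveSpecificity.not_transitive_leP3, NontransitiveSpecificity.not_transitive_ltP1,
    NontransitiveSpecificity.not_transitive_ltP2, NontransitiveSpecificity.not_transitive_ltP3⟩
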